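/- For every real-state message-passing GNN (Msg_ℓ, Up_ℓ)_{ℓ≥1} with input encoding e : Σ → ℝ, there exists a LOCAL algorithm (A_ℓ)_{ℓ≥1} with state type ℝ such that for every n ∈ ℕ, every attributed graph on n nodes over Σ, every layer ℓ ≥ 0, and every node i ∈ Fin n, running the LOCAL algorithm on the encoded attributes i ↦ e (a i) produces states satisfying s_i(ℓ) = x_i(ℓ). (Direction 'for any GNN there exists an equivalent LOCAL algorithm' of the Equivalence Theorem between message-passing GNNs and the LOCAL model.) -/

import Mathlib

/-- The closed neighborhood `N*(i) = {i} ∪ {j | G.Adj i j}` of a node, as a `Finset`. -/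
noncomputable def Nstar {n : ℕ} (G : SimpleGraph (Fin n)) (i : Fin n) : Finset (Fin n) := by
  classical exact Finset.univ.filter (fun j => j = i ∨ G.Adj i j)

/-- The state `x_i(ℓ)` of a real-state message-passing GNN with messaging functions
`Msg`, update functions `Up` and input encoding `e`, run on the attributed graph
`(G, a, β)` on `n` nodes.  Node identifiers are the casts of `Fin n` to `ℕ`. -/
noncomputable def gnnState {n : ℕ} {α : Type*}
    (Msg : ℕ → ℝ × ℝ × ℕ × ℕ × ℕ → ℝ) (Up : ℕ → ℝ → ℝ) (e : α → ℝ)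
    (G : SimpleGraph (Fin n)) (a : Fin n → α) (β : Fin n → Fin n → ℕ) :
    ℕ → Fin n → ℝ
  | 0, i => e (a i)
  | (ℓ+1), i => Up (ℓ+1) (∑ j ∈ Nstar G i,
      Msg (ℓ+1) (gnnState Msg Up e G a β ℓ i, gnnState Msg Up e G a β ℓ j,
        (i : ℕ), (j : ℕ), β i j))

/-- The state `s_i(ℓ)` of a LOCAL algorithm `A` with state type `α`, run on the
attributed graph `(G, a, β)` on `n` nodes. -/
noncomputable def localState {n : ℕ} {α : Type*}
    (A : ℕ → Multiset (α × ℕ × ℕ) × ℕ → α)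
    (G : SimpleGraph (Fin n)) (a : Fin n → α) (β : Fin n → Fin n → ℕ) :
    ℕ → Fin n → α
  | 0, i => a i
  | (ℓ+1), i => A (ℓ+1) (((Nstar G i).val).map
      (fun j => (localState A G a β ℓ j, (j : ℕ), β i j)), (i : ℕ))

theorem mem_Nstar_self {n : ℕ} (G : SimpleGraph (Fin n)) (i : Fin n) : i ∈ Nstar G i := by
  simp [Nstar]

/-- The sum of the states carrying identifier `i` in a multiset of labelled states; when
identifiers are unique this is the state of node `i`. -/
noncomputable def ownState (M : Multiset (ℝ × ℕ × ℕ)) (i : ℕ) : ℝ :=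
  (M.map fun t => if t.2.1 = i then t.1 else 0).sum

theorem ownState_map_val {n : ℕ} (s : Finset (Fin n)) (x : Fin n → ℝ) (b : Fin n → ℕ)
    {i : Fin n} (hi : i ∈ s) :
    ownState (s.val.map fun j => (x j, (j : ℕ), b j)) i = x i := by
  have h : ownState (s.val.map fun j => (x j, (j : ℕ), b j)) i
      = ∑ j ∈ s, if (j : ℕ) = i then x j else 0 := by
    simp [ownState, Multiset.map_map]
  simp [h, Fin.val_inj, hi]

/-- The LOCAL algorithm simulating a message-passing GNN: it recovers the state of the node
from its identifier, evaluates all messages, and updates with their sum. -/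
noncomputable def simulatingLocal (Msg : ℕ → ℝ × ℝ × ℕ × ℕ × ℕ → ℝ) (Up : ℕ → ℝ → ℝ)
    (ℓ : ℕ) (p : Multiset (ℝ × ℕ × ℕ) × ℕ) : ℝ :=
  Up ℓ (p.1.map fun t => Msg ℓ (ownState p.1 p.2, t.1, p.2, t.2.1, t.2.2)).sum

/-- **Equivalence Theorem, GNN → LOCAL direction.**  For every real-state message-passing
GNN `(Msg, Up)` with input encoding `e : α → ℝ`, there exists a LOCAL algorithm `A` with
state type `ℝ` such that, on every attributed graph on `n` nodes over `α`, running the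
LOCAL algorithm on the encoded attributes `i ↦ e (a i)` reproduces the GNN states:
`s_i(ℓ) = x_i(ℓ)` for every layer `ℓ` and node `i`. -/
theorem gnn_to_local_equivalence (α : Type)
    (Msg : ℕ → ℝ × ℝ × ℕ × ℕ × ℕ → ℝ) (Up : ℕ → ℝ → ℝ) (e : α → ℝ) :
    ∃ A : ℕ → Multiset (ℝ × ℕ × ℕ) × ℕ → ℝ,
      ∀ (n : ℕ) (G : SimpleGraph (Fin n)) (a : Fin n → α) (β : Fin n → Fin n → ℕ)
        (ℓ : ℕ) (i : Fin n),
        localState A G (fun i => e (a i)) β ℓ i = gnnState Msg Up e G a β ℓ i := by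
  refine ⟨simulatingLocal Msg Up, fun n G a β ℓ => ?_⟩
  induction ℓ with
  | zero => exact fun i => rfl
  | succ ℓ ih =>
    intro i
    simp only [localState, gnnState, simulatingLocal, ih,
      ownState_map_val _ _ _ (mem_Nstar_self G i), Multiset.map_map, Function.comp_def,
      Finset.sum]
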